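/- Let H ∈ (0,1) and let X = (X_y)_{y∈[0,π]} be a jointly measurable real-valued Gaussian process with a.s. integrable sample paths such that the process Y_y := ∫₀^y X_z dz is strongly locally nondeterministic with parameter 1+H ((1+H)-SLND). Then for every α > H one has P( Γ_α(X) > 0 ) = 1, where Γ_α is evaluated pathwise on the sample paths of X. -/

import Mathlib

open MeasureTheory Real Set
open scoped ENNReal NNReal

noncomputable section

/-- Second difference operator `Δ²_δ f(y) = f(y+2δ) − 2f(y+δ) + f(y)`. -/
def secondDiff (δ : ℝ) (f : ℝ → ℝ) (y : ℝ) : ℝ := f (y + 2 * δ) - 2 * f (y + δ) + f y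

/-- `G_α(ȳ,δ) = ∫_{ȳ}^{ȳ+δ} |Δ²_δ ψ(y)|^{−1/(1+α)} dy`, with `0^{−1/(1+α)} = +∞`. -/
def Gfun (α : ℝ) (ψ : ℝ → ℝ) (ybar δ : ℝ) : ℝ≥0∞ :=
  ∫⁻ y in Set.Ioc ybar (ybar + δ),
    (ENNReal.ofReal |secondDiff δ ψ y|) ^ (-(1 / (1 + α)))

/-- ψ(y) = ∫₀^y u(z) dz for `u ∈ L¹(0,π)` extended by zero outside `[0,π]`. -/
def primOfI (u : ℝ → ℝ) (y : ℝ) : ℝ :=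
  ∫ z in (0:ℝ)..y, Set.indicator (Set.Icc 0 π) u z

/-- Wei's quantity `Γ_β(u)` for `u ∈ L¹(0,π)` (extended by zero outside `[0,π]`). -/
def GammaI (β : ℝ) (u : ℝ → ℝ) : ℝ :=
  Real.sqrt (sInf {v : ℝ | ∃ δ ∈ Set.Ioo (0:ℝ) 1, ∃ ybar ∈ Set.Icc (0:ℝ) (π - δ),
    ∃ c₁ c₂ : ℝ,
    v = δ ^ (-(2 * β + 3)) * ∫ y in ybar..(ybar + δ), (primOfI u y - c₁ - c₂ * y) ^ 2})

/-- The process `Y` (indexed by `[0,T]`) is a Gaussian process: every finite real linear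
combination of its values has a Gaussian law. -/
def IsGaussianProcess {Ω : Type} [MeasurableSpace Ω] (P : Measure Ω)
    (Y : ℝ → Ω → ℝ) : Prop :=
  ∀ (n : ℕ) (ys : Fin n → ℝ) (c : Fin n → ℝ), ∃ (m : ℝ) (v : ℝ≥0),
    P.map (fun ω => ∑ i, c i * Y (ys i) ω) = ProbabilityTheory.gaussianReal m v

/-- Natural filtration of a process at time `s` (σ-algebra generated by `Y_r`, `0 ≤ r ≤ s`). -/
def natFilt {Ω : Type} (Y : ℝ → Ω → ℝ) (s : ℝ) : MeasurableSpace Ω :=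
  ⨆ r ∈ Set.Icc (0:ℝ) s, MeasurableSpace.comap (Y r) inferInstance

/-- `Y` is strongly locally nondeterministic with parameter `β` and constant `C` on `[0,T]`:
`Var(Y_t | F_s) ≥ C (t−s)^{2β}`. -/
def SLND {Ω : Type} [MeasurableSpace Ω] (P : Measure Ω) (Y : ℝ → Ω → ℝ)
    (T β C : ℝ) : Prop :=
  ∀ s t : ℝ, 0 ≤ s → s < t → t ≤ T →
    ∀ᵐ ω ∂P, C * (t - s) ^ (2 * β) ≤
      (P[fun ω' => (Y t ω' - (P[Y t | natFilt Y s]) ω') ^ 2 | natFilt Y s]) ω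

section GaussianTools

open ProbabilityTheory hiding IsGaussianProcess
open Filter Topology

/-- A law whose characteristic function is a pointwise limit of characteristic functions of real
Gaussian laws is Gaussian. -/
lemma exists_gaussianReal_of_tendsto_charFun {μ : Measure ℝ} [IsProbabilityMeasure μ]
    {m : ℕ → ℝ} {v : ℕ → ℝ≥0}
    (h : ∀ t, Tendsto (fun n => charFun (gaussianReal (m n) (v n)) t) atTop (𝓝 (charFun μ t))) :
    ∃ (m' : ℝ) (v' : ℝ≥0), μ = gaussianReal m' v' := by
  have hcont : Continuous (charFun μ) := continuous_charFun
  have hnorm : ∀ n t, ‖charFun (gaussianReal (m n) (v n)) t‖ = Real.exp (-(v n * t ^ 2 / 2)) := by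
    intro n t
    rw [charFun_gaussianReal, Complex.norm_exp]
    congr 1
    have : ((t : ℂ) * (m n) * Complex.I - (v n : ℝ) * (t : ℂ) ^ 2 / 2)
        = ((-(v n * t ^ 2 / 2) : ℝ) : ℂ) + ((t * m n : ℝ) : ℂ) * Complex.I := by
      push_cast; ring
    rw [this, Complex.add_re, Complex.ofReal_re, Complex.re_ofReal_mul]; simp
  obtain ⟨t₀, ht₀, hφ⟩ : ∃ t₀ : ℝ, 0 < t₀ ∧ charFun μ t₀ ≠ 0 := by
    have h0 : charFun μ 0 ≠ 0 := by simp
    have h1 : ∀ᶠ t in 𝓝 (0 : ℝ), charFun μ t ≠ 0 := hcont.continuousAt.eventually_ne h0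
    have h2 : ∀ᶠ t in 𝓝[>] (0 : ℝ), charFun μ t ≠ 0 := h1.filter_mono nhdsWithin_le_nhds
    obtain ⟨t, ht, ht'⟩ := (h2.and self_mem_nhdsWithin).exists
    exact ⟨t, ht', ht⟩
  have hv : Tendsto (fun n => (v n : ℝ)) atTop
      (𝓝 (-2 * Real.log ‖charFun μ t₀‖ / t₀ ^ 2)) := by
    have h1 := ((h t₀).norm.log (norm_ne_zero_iff.2 hφ)).const_mul (-2) |>.div_const (t₀ ^ 2)
    refine h1.congr fun n => ?_
    rw [hnorm, Real.log_exp]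
    field_simp
  set w := -2 * Real.log ‖charFun μ t₀‖ / t₀ ^ 2 with hw
  have hw0 : 0 ≤ w := ge_of_tendsto' hv fun n => (v n).2
  set g : ℝ → ℂ := fun t => charFun μ t * Complex.exp ((w * t ^ 2 / 2 : ℝ)) with hg
  have hgc : Continuous g := by fun_prop
  have hexp : ∀ t : ℝ, Tendsto (fun n => Complex.exp (m n * Complex.I * t)) atTop (𝓝 (g t)) := by
    intro t
    have h2 : Tendsto (fun n => Complex.exp ((v n * t ^ 2 / 2 : ℝ))) atTop
        (𝓝 (Complex.exp ((w * t ^ 2 / 2 : ℝ)))) := by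
      refine (Complex.continuous_exp.comp Complex.continuous_ofReal).continuousAt.tendsto.comp ?_
      exact (hv.mul_const _).div_const _
    refine ((h t).mul h2).congr fun n => ?_
    rw [charFun_gaussianReal, ← Complex.exp_add]
    congr 1
    push_cast
    ring
  obtain ⟨a, ha⟩ : ∃ a : ℝ, ∫ t in (0 : ℝ)..a, g t ≠ 0 := by
    have hd : HasDerivAt (fun a => ∫ t in (0 : ℝ)..a, g t) (g 0) 0 :=
      intervalIntegral.integral_hasDerivAt_right (hgc.intervalIntegrable _ _)
        (hgc.stronglyMeasurableAtFilter _ _) hgc.continuousAt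
    have hg0 : g 0 ≠ 0 := by simp [hg]
    exact (hd.eventually_ne hg0 (c := 0)).exists
  have hint : Tendsto (fun n => ∫ t in (0 : ℝ)..a, Complex.exp (m n * Complex.I * t)) atTop
      (𝓝 (∫ t in (0 : ℝ)..a, g t)) := by
    refine intervalIntegral.tendsto_integral_filter_of_dominated_convergence (fun _ => 1)
      (Eventually.of_forall fun n => ?_) (Eventually.of_forall fun n => ?_) (by simp)
      (ae_of_all _ fun t _ => hexp t)
    · exact (by fun_prop : Continuous fun t : ℝ =>
        Complex.exp (m n * Complex.I * t)).aestronglyMeasurable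
    · refine ae_of_all _ fun t _ => ?_
      rw [Complex.norm_exp]; simp
  have hm : ∃ m', Tendsto m atTop (𝓝 m') := by
    have h1 : Tendsto (fun n => ((Complex.exp (m n * Complex.I * a) - 1) /
        ((∫ t in (0 : ℝ)..a, Complex.exp (m n * Complex.I * t)) * Complex.I)).re) atTop
        (𝓝 ((g a - 1) / ((∫ t in (0 : ℝ)..a, g t) * Complex.I)).re) :=
      (Complex.continuous_re.tendsto _).comp
        (((hexp a).sub_const 1).div (hint.mul_const _) (mul_ne_zero ha Complex.I_ne_zero))
    refine ⟨_, h1.congr' ?_⟩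
    filter_upwards [hint.eventually_ne ha] with n hn
    by_cases h0 : m n = 0
    · simp [h0]
    have h0' : (m n : ℂ) * Complex.I ≠ 0 := by simp [h0]
    rw [integral_exp_mul_complex h0'] at hn ⊢
    have h3 : Complex.exp (m n * Complex.I * a) - 1 ≠ 0 := by
      intro h3; simp [h3] at hn
    have : ((Complex.exp (m n * Complex.I * a) - 1) /
        ((Complex.exp (m n * Complex.I * a) - Complex.exp (m n * Complex.I * (0 : ℝ))) /
          (m n * Complex.I) * Complex.I)) = m n := by
      rw [Complex.ofReal_zero, mul_zero, Complex.exp_zero]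
      have := Complex.I_ne_zero
      field_simp
    rw [this, Complex.ofReal_re]
  obtain ⟨m', hm'⟩ := hm
  obtain ⟨w', hw'⟩ : ∃ w' : ℝ≥0, (w' : ℝ) = w := ⟨⟨w, hw0⟩, rfl⟩
  refine ⟨m', w', Measure.ext_of_charFun ?_⟩
  ext t
  refine tendsto_nhds_unique (h t) ?_
  simp only [charFun_gaussianReal, hw']
  refine (Complex.continuous_exp.tendsto _).comp ?_
  have e1 := (Complex.continuous_ofReal.tendsto _).comp hm'
  have e2 := (Complex.continuous_ofReal.tendsto _).comp hv
  exact ((e1.const_mul (t : ℂ)).mul_const _).sub ((e2.mul_const _).div_const _)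

/-- An almost sure limit of real Gaussian random variables is Gaussian. -/
lemma hasGaussianLaw_of_ae_tendsto {Ω : Type*} [MeasurableSpace Ω] {P : Measure Ω}
    [IsProbabilityMeasure P] {ξ : ℕ → Ω → ℝ} {η : Ω → ℝ} (hξ : ∀ n, HasGaussianLaw (ξ n) P)
    (hlim : ∀ᵐ ω ∂P, Tendsto (fun n => ξ n ω) atTop (𝓝 (η ω))) : HasGaussianLaw η P := by
  have hηm : AEMeasurable η P :=
    aemeasurable_of_tendsto_metrizable_ae atTop (fun n => (hξ n).aemeasurable) hlim
  have : IsProbabilityMeasure (P.map η) := Measure.isProbabilityMeasure_map hηm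
  have key : ∃ (m' : ℝ) (v' : ℝ≥0), P.map η = gaussianReal m' v' := by
    refine exists_gaussianReal_of_tendsto_charFun (m := fun n => P[ξ n])
      (v := fun n => (Var[ξ n; P]).toNNReal) fun t => ?_
    simp_rw [← (hξ _).map_eq_gaussianReal, charFun_apply_real]
    have hmeas : ∀ {μ : Measure ℝ},
        AEStronglyMeasurable (fun x : ℝ => Complex.exp (t * x * Complex.I)) μ :=
      (by fun_prop : Continuous fun x : ℝ => Complex.exp (t * x * Complex.I)).aestronglyMeasurable
    rw [integral_map hηm hmeas]
    simp_rw [fun n => integral_map (hξ n).aemeasurable (hmeas (μ := P.map (ξ n)))]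
    refine tendsto_integral_of_dominated_convergence (fun _ => 1) (fun n => ?_)
      (integrable_const _) (fun n => ?_) ?_
    · have := (hξ n).aemeasurable
      exact AEMeasurable.aestronglyMeasurable (by fun_prop)
    · refine ae_of_all _ fun ω => ?_
      rw [Complex.norm_exp]; simp
    · filter_upwards [hlim] with ω hω
      exact ((by fun_prop : Continuous fun x : ℝ =>
        Complex.exp (t * x * Complex.I)).tendsto _).comp hω
  obtain ⟨m', v', h⟩ := key
  exact ⟨h ▸ isGaussian_gaussianReal m' v'⟩

/-- A real Gaussian law of variance at least `σ ^ 2` gives mass at most `r / σ` to an interval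
of half-length `r`. -/
lemma gaussianReal_closedBall_le {m σ c r : ℝ} {v : ℝ≥0} (hσ : 0 < σ) (hv : σ ^ 2 ≤ v) :
    gaussianReal m v (Metric.closedBall c r) ≤ ENNReal.ofReal (r / σ) := by
  have hv0 : v ≠ 0 := by
    rintro rfl
    have : 0 < σ ^ 2 := by positivity
    simp at hv; linarith
  have hpdf : ∀ x, gaussianPDF m v x ≤ ENNReal.ofReal ((2 * σ)⁻¹) := by
    intro x
    refine ENNReal.ofReal_le_ofReal ?_
    rw [gaussianPDFReal_def]
    have h1 : rexp (-(x - m) ^ 2 / (2 * v)) ≤ 1 := by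
      rw [Real.exp_le_one_iff]
      exact div_nonpos_of_nonpos_of_nonneg (by nlinarith [sq_nonneg (x - m)]) (by positivity)
    have h2 : 2 * σ ≤ √(2 * π * v) := by
      refine Real.le_sqrt_of_sq_le ?_
      have := Real.pi_gt_three
      nlinarith [sq_nonneg σ]
    calc (√(2 * π * v))⁻¹ * rexp (-(x - m) ^ 2 / (2 * v)) ≤ (2 * σ)⁻¹ * 1 := by
          gcongr
      _ = _ := mul_one _
  rw [gaussianReal_apply _ hv0]
  calc ∫⁻ x in Metric.closedBall c r, gaussianPDF m v x
      ≤ ∫⁻ x in Metric.closedBall c r, ENNReal.ofReal ((2 * σ)⁻¹) := lintegral_mono fun x => hpdf x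
    _ = ENNReal.ofReal ((2 * σ)⁻¹) * ENNReal.ofReal (2 * r) := by
        rw [setLIntegral_const, Real.volume_closedBall]
    _ = ENNReal.ofReal (r / σ) := by
        rw [← ENNReal.ofReal_mul (by positivity)]
        congr 1
        field_simp

/-- Linear regression: finitely many square integrable variables are uncorrelated with a suitable
residual of a further one. -/
lemma exists_covariance_sub_sum_eq_zero {Ω ι : Type*} [Fintype ι] [MeasurableSpace Ω]
    {P : Measure Ω} [IsProbabilityMeasure P] {W : ι → Ω → ℝ} {T : Ω → ℝ}
    (hW : ∀ i, MemLp (W i) 2 P) (hT : MemLp T 2 P) :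
    ∃ b : ι → ℝ, ∀ i, cov[W i, fun ω => T ω - ∑ j, b j * W j ω; P] = 0 := by
  have hW' : ∀ i, MemLp (fun ω => W i ω - P[W i]) 2 P := fun i => (hW i).sub (memLp_const _)
  have hT' : MemLp (fun ω => T ω - P[T]) 2 P := hT.sub (memLp_const _)
  let w : ι → Lp ℝ 2 P := fun i => (hW' i).toLp
  let t : Lp ℝ 2 P := hT'.toLp
  have hfin : FiniteDimensional ℝ (Submodule.span ℝ (Set.range w)) :=
    FiniteDimensional.span_of_finite ℝ (Set.finite_range w)
  obtain ⟨y, hy, z, hz, hyz⟩ :=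
    Submodule.exists_add_mem_mem_orthogonal (K := Submodule.span ℝ (Set.range w)) t
  obtain ⟨b, hb⟩ := (Submodule.mem_span_range_iff_exists_fun ℝ).1 hy
  refine ⟨b, fun i => ?_⟩
  have h0 : inner ℝ (w i) z = 0 := hz _ (Submodule.subset_span ⟨i, rfl⟩)
  have hcov : ∀ {A : Ω → ℝ} (hA : MemLp (fun ω => A ω - P[A]) 2 P),
      inner ℝ (w i) hA.toLp = cov[W i, A; P] := by
    intro A hA
    rw [L2.inner_def, covariance]
    refine integral_congr_ae ?_
    filter_upwards [(hW' i).coeFn_toLp, hA.coeFn_toLp] with ω h1 h2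
    rw [h1, h2]
    simp [mul_comm]
  have hz' : z = t - ∑ j, b j • w j := by rw [hb, hyz]; simp
  rw [hz', inner_sub_right, inner_sum] at h0
  have ht : inner ℝ (w i) t = cov[W i, T; P] := hcov hT'
  have hw : ∀ j, inner ℝ (w i) (w j) = cov[W i, W j; P] := fun j => hcov (hW' j)
  simp only [inner_smul_right, ht, hw] at h0
  have hbW : ∀ j, MemLp (fun ω => b j * W j ω) 2 P := fun j => (hW j).const_mul _
  rw [covariance_fun_sub_right (hW i) hT (memLp_finsetSum _ fun j _ => hbW j),
    covariance_fun_sum_right hbW (hW i)]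
  simpa [covariance_const_mul_right] using h0

/-- If every linear residual of `T` given the jointly Gaussian family `W` has variance at least
`σ ^ 2`, then conditionally on `W` the law of `T` puts mass at most `r / σ` on intervals of
half-length `r`. -/
lemma measure_inter_abs_sub_le {Ω ι : Type*} [Fintype ι] [MeasurableSpace Ω]
    {P : Measure Ω} [IsProbabilityMeasure P] {W : ι → Ω → ℝ} {T : Ω → ℝ}
    (hWm : ∀ i, Measurable (W i)) (hTm : Measurable T)
    (hG : HasGaussianLaw (fun ω => ((fun i => W i ω), T ω)) P) {σ r : ℝ} (hσ : 0 < σ)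
    (hvar : ∀ b : ι → ℝ, σ ^ 2 ≤ Var[fun ω => T ω - ∑ j, b j * W j ω; P])
    {B : Set (ι → ℝ)} (hB : MeasurableSet B) {g : (ι → ℝ) → ℝ} (hg : Measurable g) :
    P {ω | (fun i => W i ω) ∈ B ∧ |T ω - g (fun i => W i ω)| ≤ r}
      ≤ ENNReal.ofReal (r / σ) * P {ω | (fun i => W i ω) ∈ B} := by
  obtain ⟨b, hb⟩ := exists_covariance_sub_sum_eq_zero (P := P)
    (fun i => (hG.fst.eval i).memLp_two) hG.snd.memLp_two
  set V : Ω → ι → ℝ := fun ω i => W i ω with hV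
  set R : Ω → ℝ := fun ω => T ω - ∑ j, b j * W j ω with hR
  have hVm : Measurable V := measurable_pi_iff.2 hWm
  have hRm : Measurable R := by fun_prop
  have hlin : HasGaussianLaw (fun ω => (V ω, fun _ : Unit => R ω)) P := by
    let L : (ι → ℝ) × ℝ →L[ℝ] (ι → ℝ) × (Unit → ℝ) :=
      (ContinuousLinearMap.fst ℝ (ι → ℝ) ℝ).prod (ContinuousLinearMap.pi fun _ =>
        ContinuousLinearMap.snd ℝ (ι → ℝ) ℝ - ∑ j, b j •
          ((ContinuousLinearMap.proj j : (ι → ℝ) →L[ℝ] ℝ).comp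
            (ContinuousLinearMap.fst ℝ (ι → ℝ) ℝ)))
    have := hG.map_fun L
    refine this.congr (ae_of_all _ fun ω => ?_)
    ext <;> simp [L, V, R]
  have hind : IndepFun V R P :=
    (hlin.indepFun_of_covariance_eval (X := W) (Y := fun _ : Unit => R) fun i _ => hb i).comp
      measurable_id (measurable_pi_apply (X := fun _ : Unit => ℝ) ())
  have hRlaw : HasGaussianLaw R P := hlin.snd.eval ()
  set E : Set ((ι → ℝ) × ℝ) := {p | p.1 ∈ B ∧ |p.2 + ∑ j, b j * p.1 j - g p.1| ≤ r} with hE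
  have hEm : MeasurableSet E :=
    (measurable_fst hB).inter (measurableSet_le
      (by fun_prop : Measurable fun p : (ι → ℝ) × ℝ => |p.2 + ∑ j, b j * p.1 j - g p.1|)
      measurable_const)
  have hset : {ω | V ω ∈ B ∧ |T ω - g (V ω)| ≤ r} = (fun ω => (V ω, R ω)) ⁻¹' E := by
    ext ω; simp [E, V, R]
  rw [hset, ← Measure.map_apply (hVm.prodMk hRm) hEm,
    (indepFun_iff_map_prod_eq_prod_map_map hVm.aemeasurable hRm.aemeasurable).1 hind]
  have : IsProbabilityMeasure (P.map V) := Measure.isProbabilityMeasure_map hVm.aemeasurable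
  have : IsProbabilityMeasure (P.map R) := Measure.isProbabilityMeasure_map hRm.aemeasurable
  rw [Measure.prod_apply hEm]
  calc ∫⁻ x, P.map R (Prod.mk x ⁻¹' E) ∂(P.map V)
      ≤ ∫⁻ x, B.indicator (fun _ => ENNReal.ofReal (r / σ)) x ∂(P.map V) := by
        refine lintegral_mono fun x => ?_
        by_cases hx : x ∈ B
        · rw [Set.indicator_of_mem hx, hRlaw.map_eq_gaussianReal]
          have : Prod.mk x ⁻¹' E ⊆ Metric.closedBall (g x - ∑ j, b j * x j) r := by
            rintro ρ ⟨-, h⟩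
            rw [Metric.mem_closedBall, Real.dist_eq]
            convert h using 2
            simp; ring
          refine (measure_mono this).trans (gaussianReal_closedBall_le hσ ?_)
          rw [Real.coe_toNNReal _ (variance_nonneg _ _)]
          exact hvar b
        · have : Prod.mk x ⁻¹' E = ∅ := by ext ρ; simp [E, hx]
          simp [this]
    _ = ENNReal.ofReal (r / σ) * P {ω | V ω ∈ B} := by
        rw [lintegral_indicator hB, setLIntegral_const, Measure.map_apply hVm hB]
        rfl

/-- Monte Carlo integration: for a jointly measurable process with almost surely `ν`-integrable
paths, a deterministic sequence of nodes computes almost surely the integrals of the paths. -/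
lemma exists_tendsto_average_integral {Ω E : Type*} [MeasurableSpace Ω] [MeasurableSpace E]
    {P : Measure Ω} [IsProbabilityMeasure P] {ν : Measure E} [IsProbabilityMeasure ν]
    {F : E → Ω → ℝ} (hF : Measurable fun p : E × Ω => F p.1 p.2)
    (hint : ∀ᵐ ω ∂P, Integrable (fun z => F z ω) ν) :
    ∃ u : ℕ → E, ∀ᵐ ω ∂P, Tendsto (fun n : ℕ => (∑ i ∈ Finset.range n, F (u i) ω) / n) atTop
      (𝓝 (∫ z, F z ω ∂ν)) := by
  let μ : Measure (ℕ → E) := Measure.infinitePi fun _ => ν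
  have hLLN : ∀ᵐ ω ∂P, ∀ᵐ u ∂μ,
      Tendsto (fun n : ℕ => (∑ i ∈ Finset.range n, F (u i) ω) / n) atTop
        (𝓝 (∫ z, F z ω ∂ν)) := by
    filter_upwards [hint] with ω hω
    have hm : Measurable fun z => F z ω := hF.comp (measurable_id.prodMk measurable_const)
    have hev : ∀ i, MeasurePreserving (fun u : ℕ → E => u i) μ ν := fun i =>
      measurePreserving_eval_infinitePi (fun _ => ν) i
    have hident : ∀ i, IdentDistrib (fun u : ℕ → E => F (u i) ω) (fun u => F (u 0) ω) μ μ := by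
      intro i
      refine ⟨(hm.comp (hev i).measurable).aemeasurable, (hm.comp (hev 0).measurable).aemeasurable,
        ?_⟩
      have h : ∀ j, μ.map (fun u : ℕ → E => F (u j) ω) = ν.map fun z => F z ω := fun j => by
        rw [← (hev j).map_eq, Measure.map_map hm (hev j).measurable]; rfl
      rw [h, h]
    have hind : Pairwise fun i j =>
        IndepFun (fun u : ℕ → E => F (u i) ω) (fun u => F (u j) ω) μ := fun i j hij =>
      (iIndepFun_infinitePi (P := fun _ : ℕ => ν) (X := fun _ z => F z ω) fun _ => hm).indepFun hij
    have hi0 : Integrable (fun u : ℕ → E => F (u 0) ω) μ :=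
      (hev 0).integrable_comp_of_integrable hω
    have := strong_law_ae_real (fun i (u : ℕ → E) => F (u i) ω) hi0 hind hident
    have hexp : ∫ u, F (u 0) ω ∂μ = ∫ z, F z ω ∂ν := by
      rw [← (hev 0).map_eq, integral_map (hev 0).measurable.aemeasurable hm.aestronglyMeasurable]
    simpa only [hexp] using this
  have hmeas : MeasurableSet {x : Ω × (ℕ → E) |
      Tendsto (fun n : ℕ => (∑ i ∈ Finset.range n, F (x.2 i) x.1) / n) atTop
        (𝓝 (∫ z, F z x.1 ∂ν))} := by
    refine measurableSet_tendsto_fun (fun n => ?_) ?_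
    · refine (Finset.measurable_sum _ fun i _ => ?_).div_const _
      have hi : Measurable fun x : Ω × (ℕ → E) => (x.2 i, x.1) :=
        ((measurable_pi_apply i).comp measurable_snd).prodMk measurable_fst
      exact hF.comp hi
    · exact ((hF.comp measurable_swap).stronglyMeasurable.integral_prod_right'
        (ν := ν)).measurable.comp measurable_fst
  exact ((Measure.ae_ae_comm hmeas).1 hLLN).exists

/-- The primitive of a jointly measurable process is jointly measurable. -/
lemma measurable_primitive {Ω : Type*} [MeasurableSpace Ω] {X : ℝ → Ω → ℝ}
    (hX : Measurable fun p : ℝ × Ω => X p.1 p.2) :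
    Measurable fun p : ℝ × Ω => ∫ z in (0 : ℝ)..p.1, X z p.2 := by
  have hX' : Measurable fun q : (ℝ × Ω) × ℝ => X q.2 q.1.2 :=
    hX.comp (measurable_snd.prodMk (measurable_snd.comp measurable_fst))
  have hind : ∀ {S : Set ((ℝ × Ω) × ℝ)}, MeasurableSet S →
      Measurable fun p : ℝ × Ω => ∫ z, S.indicator (fun q => X q.2 q.1.2) (p, z) := fun hS =>
    ((hX'.indicator hS).stronglyMeasurable.integral_prod_right').measurable
  have h1 := hind (S := {q | 0 < q.2 ∧ q.2 ≤ q.1.1})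
    ((measurableSet_lt measurable_const measurable_snd).inter
      (measurableSet_le measurable_snd (measurable_fst.comp measurable_fst)))
  have h2 := hind (S := {q | q.1.1 < q.2 ∧ q.2 ≤ 0})
    ((measurableSet_lt (measurable_fst.comp measurable_fst) measurable_snd).inter
      (measurableSet_le measurable_snd measurable_const))
  convert h1.sub h2 using 1
  funext p
  rw [intervalIntegral, ← integral_indicator measurableSet_Ioc,
    ← integral_indicator measurableSet_Ioc]
  rfl

/-- Linear combinations of values of the primitive of a measurable Gaussian process with integrable
paths are Gaussian. -/
lemma hasGaussianLaw_sum_primitive {Ω : Type} [MeasurableSpace Ω] {P : Measure Ω}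
    [IsProbabilityMeasure P] {X : ℝ → Ω → ℝ} (hX_meas : Measurable fun p : ℝ × Ω => X p.1 p.2)
    (hX_gauss : _root_.IsGaussianProcess P X)
    (hX_int : ∀ᵐ ω ∂P, IntegrableOn (fun y => X y ω) (Set.Icc 0 π))
    {ι : Type*} [Fintype ι] {t : ι → ℝ} (ht : ∀ i, t i ∈ Set.Icc 0 π) (c : ι → ℝ) :
    HasGaussianLaw (fun ω => ∑ i, c i * ∫ z in (0 : ℝ)..t i, X z ω) P := by
  let w : ℝ → ℝ := fun z => ∑ i, (Set.Ioc 0 (t i)).indicator (fun _ => c i) z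
  have hw : Measurable w :=
    Finset.measurable_sum _ fun i _ => measurable_const.indicator measurableSet_Ioc
  have hterm : ∀ i z ω, (Set.Ioc 0 (t i)).indicator (fun _ => c i) z * X z ω
      = (Set.Ioc 0 (t i)).indicator (fun z => c i * X z ω) z := by
    intro i z ω
    by_cases hz : z ∈ Set.Ioc 0 (t i) <;> simp [hz]
  have hvol : volume (Set.Icc 0 π) = ENNReal.ofReal π := by simp
  have hvol0 : volume (Set.Icc 0 π) ≠ 0 := by
    rw [hvol]; simpa using Real.pi_pos
  have hvolt : volume (Set.Icc 0 π) ≠ ∞ := by rw [hvol]; simp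
  let ν : Measure ℝ := (volume (Set.Icc 0 π))⁻¹ • volume.restrict (Set.Icc 0 π)
  have hν : IsProbabilityMeasure ν := ⟨by
    simp only [ν, Measure.smul_apply, Measure.restrict_apply_univ, smul_eq_mul]
    exact ENNReal.inv_mul_cancel hvol0 hvolt⟩
  have hsub : ∀ i, Set.Ioc 0 (t i) ⊆ Set.Icc 0 π := fun i z hz =>
    ⟨hz.1.le, hz.2.trans (ht i).2⟩
  have hpieces : ∀ ω, IntegrableOn (fun y => X y ω) (Set.Icc 0 π) → ∀ i,
      IntegrableOn ((Set.Ioc 0 (t i)).indicator fun z => c i * X z ω) (Set.Icc 0 π) :=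
    fun ω hω i => (hω.const_mul (c i)).indicator measurableSet_Ioc
  have hwX : ∀ ω, (fun z => w z * X z ω)
      = fun z => ∑ i, (Set.Ioc 0 (t i)).indicator (fun z => c i * X z ω) z := by
    intro ω; funext z
    simp only [w, Finset.sum_mul, hterm]
  obtain ⟨u, hu⟩ := exists_tendsto_average_integral (P := P) (ν := ν)
    (F := fun z ω => w z * X z ω) ((hw.comp measurable_fst).mul hX_meas) (by
      filter_upwards [hX_int] with ω hω
      rw [hwX]
      exact (integrable_finsetSum _ fun i _ => hpieces ω hω i).smul_measure
        (ENNReal.inv_ne_top.2 hvol0))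
  refine hasGaussianLaw_of_ae_tendsto
    (ξ := fun n ω => π * ((∑ i ∈ Finset.range n, w (u i) * X (u i) ω) / n)) (fun n => ?_) ?_
  · obtain ⟨m, v, h⟩ := hX_gauss n (fun i => u i) (fun i => π * w (u i) / n)
    refine ⟨?_⟩
    have : (fun ω => π * ((∑ i ∈ Finset.range n, w (u i) * X (u i) ω) / n))
        = fun ω => ∑ i : Fin n, π * w (u i) / n * X (u i) ω := by
      funext ω
      rw [Finset.sum_range, Finset.sum_div, Finset.mul_sum]
      exact Finset.sum_congr rfl fun i _ => by ring
    rw [this, h]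
    exact isGaussian_gaussianReal m v
  · filter_upwards [hu, hX_int] with ω hω hi
    convert hω.const_mul π using 2
    rw [integral_smul_measure, hwX, integral_finsetSum _ fun i _ => hpieces ω hi i, hvol,
      ENNReal.toReal_inv, ENNReal.toReal_ofReal Real.pi_pos.le, smul_eq_mul,
      mul_inv_cancel_left₀ Real.pi_pos.ne']
    refine Finset.sum_congr rfl fun i _ => ?_
    rw [intervalIntegral.integral_of_le (ht i).1, setIntegral_indicator measurableSet_Ioc,
      Set.inter_eq_self_of_subset_right (hsub i), integral_const_mul]

/-- Finite families of values of the primitive of a measurable Gaussian process with integrable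
paths are jointly Gaussian. -/
lemma hasGaussianLaw_primitive_prod {Ω : Type} [MeasurableSpace Ω] {P : Measure Ω}
    [IsProbabilityMeasure P] {X : ℝ → Ω → ℝ} (hX_meas : Measurable fun p : ℝ × Ω => X p.1 p.2)
    (hX_gauss : _root_.IsGaussianProcess P X)
    (hX_int : ∀ᵐ ω ∂P, IntegrableOn (fun y => X y ω) (Set.Icc 0 π))
    {ι : Type*} [Fintype ι] {s : ι → ℝ} (hs : ∀ i, s i ∈ Set.Icc 0 π) {t : ℝ}
    (ht : t ∈ Set.Icc 0 π) :
    HasGaussianLaw (fun ω => ((fun i => ∫ z in (0 : ℝ)..s i, X z ω),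
      ∫ z in (0 : ℝ)..t, X z ω)) P := by
  classical
  have hY : ∀ y, Measurable fun ω => ∫ z in (0 : ℝ)..y, X z ω := fun y =>
    (measurable_primitive hX_meas).comp (measurable_const.prodMk measurable_id)
  have hm : Measurable fun ω => ((fun i => ∫ z in (0 : ℝ)..s i, X z ω),
      ∫ z in (0 : ℝ)..t, X z ω) := (measurable_pi_iff.2 fun i => hY _).prodMk (hY t)
  refine ⟨isGaussian_of_map_eq_gaussianReal fun L => ?_⟩
  have hG := hasGaussianLaw_sum_primitive hX_meas hX_gauss hX_int
    (t := fun o : Option ι => o.elim t s) (fun o => by cases o <;> simp [ht, hs, -Set.mem_Icc])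
    (fun o => o.elim (L (0, 1)) fun i => L (Pi.single i 1, 0))
  rw [Measure.map_map L.continuous.measurable hm]
  refine ⟨_, _, Eq.trans ?_ hG.map_eq_gaussianReal⟩
  congr 1
  funext ω
  have key : ∀ p : (ι → ℝ) × ℝ, L p = p.2 * L (0, 1) + ∑ i, p.1 i * L (Pi.single i 1, 0) := by
    intro p
    have hp : p = p.2 • ((0, 1) : (ι → ℝ) × ℝ)
        + ∑ i, p.1 i • ((Pi.single i 1, 0) : (ι → ℝ) × ℝ) := by
      refine Prod.ext ?_ ?_
      · funext j
        simp [Prod.fst_sum, Pi.single_apply]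
      · simp [Prod.snd_sum]
    conv_lhs => rw [hp]
    simp only [map_add, map_sum, map_smul, smul_eq_mul]
  rw [Function.comp_apply, key, Fintype.sum_option]
  simp only [Option.elim]
  congr 1
  · ring
  · exact Finset.sum_congr rfl fun i _ => mul_comm _ _

/-- Under strong local nondeterminism, every linear residual of `Y t` given finitely many values
of `Y` before time `s` has variance at least `C (t - s) ^ (2 β)`. -/
lemma SLND.le_variance_sub_sum {Ω : Type} [MeasurableSpace Ω] {P : Measure Ω}
    [IsProbabilityMeasure P] {Y : ℝ → Ω → ℝ} {T β C : ℝ} (hY : SLND P Y T β C)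
    (hYm : ∀ y, Measurable (Y y)) {s t : ℝ} (hs : 0 ≤ s) (hst : s < t) (htT : t ≤ T)
    {ι : Type*} [Fintype ι] {r : ι → ℝ} (hr : ∀ i, r i ∈ Set.Icc 0 s)
    (hY2 : ∀ y ∈ Set.Icc 0 T, MemLp (Y y) 2 P) (b : ι → ℝ) :
    C * (t - s) ^ (2 * β) ≤ Var[fun ω => Y t ω - ∑ j, b j * Y (r j) ω; P] := by
  have hm : natFilt Y s ≤ ‹MeasurableSpace Ω› :=
    iSup₂_le fun y _ => (hYm y).comap_le
  have ht2 : MemLp (Y t) 2 P := hY2 t ⟨by linarith, htT⟩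
  set S : Ω → ℝ := fun ω => ∑ j, b j * Y (r j) ω with hS
  have hS2 : MemLp S 2 P := memLp_finsetSum _ fun j _ =>
    (hY2 (r j) ⟨(hr j).1, by linarith [(hr j).2]⟩).const_mul _
  have hSm : Measurable[natFilt Y s] S := by
    refine Finset.measurable_sum _ fun j _ => Measurable.const_mul ?_ _
    exact (comap_measurable (Y (r j))).mono (le_iSup₂_of_le (r j) (hr j) le_rfl) le_rfl
  have hcond : P[fun ω => Y t ω - S ω | natFilt Y s]
      =ᵐ[P] fun ω => P[Y t | natFilt Y s] ω - S ω := by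
    refine (condExp_sub (ht2.integrable one_le_two) (hS2.integrable one_le_two) _).trans ?_
    rw [condExp_of_stronglyMeasurable hm hSm.stronglyMeasurable (hS2.integrable one_le_two)]
    rfl
  have hvar : Var[fun ω => Y t ω - S ω; P | natFilt Y s]
      =ᵐ[P] P[fun ω => (Y t ω - P[Y t | natFilt Y s] ω) ^ 2 | natFilt Y s] := by
    refine condExp_congr_ae ?_
    filter_upwards [hcond] with ω hω
    simp [hω]
  have hint := integral_condVar_add_variance_condExp hm (ht2.sub hS2)
  calc C * (t - s) ^ (2 * β) = ∫ _, C * (t - s) ^ (2 * β) ∂P := by simp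
    _ ≤ ∫ ω, (Var[fun ω => Y t ω - S ω; P | natFilt Y s]) ω ∂P := by
        refine integral_mono_ae (integrable_const _) integrable_condVar ?_
        filter_upwards [hY s t hs hst htT, hvar] with ω h1 h2
        rw [h2]; exact h1
    _ ≤ Var[fun ω => Y t ω - S ω; P] := by
        rw [← show _ = Var[fun ω => Y t ω - S ω; P] from hint]
        exact le_add_of_nonneg_right (variance_nonneg _ _)

/-- Joint small ball estimate for separated second differences of a Gaussian process. -/
lemma SLND.measure_forall_abs_secondDiff_le {Ω : Type} [MeasurableSpace Ω] {P : Measure Ω}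
    [IsProbabilityMeasure P] {Y : ℝ → Ω → ℝ} {T β C : ℝ} (hY : SLND P Y T β C)
    (hYm : ∀ y, Measurable (Y y)) (hC : 0 < C)
    (hYG : ∀ (n : ℕ) (s : Fin (n + 1) × Fin 3 → ℝ), (∀ i, s i ∈ Set.Icc 0 T) →
      ∀ t ∈ Set.Icc 0 T, HasGaussianLaw (fun ω => ((fun i => Y (s i) ω), Y t ω)) P)
    {h r : ℝ} (hh : 0 < h) {y : ℕ → ℝ} {N : ℕ} (hy0 : ∀ k < N, 0 ≤ y k)
    (hyT : ∀ k < N, y k + 2 * h ≤ T) (hsep : ∀ j k, j < k → k < N → y j + h ≤ y k) :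
    P {ω | ∀ k < N, |secondDiff h (fun z => Y z ω) (y k)| ≤ r}
      ≤ ENNReal.ofReal (r / (√C * h ^ β)) ^ N := by
  have hY2 : ∀ z ∈ Set.Icc 0 T, MemLp (Y z) 2 P := fun z hz =>
    (hYG 0 (fun _ => z) (fun _ => hz) z hz).snd.memLp_two
  induction N with
  | zero => simp
  | succ n ih =>
    have ih' := ih (fun k hk => hy0 k (by omega)) (fun k hk => hyT k (by omega))
      (fun j k hjk hk => hsep j k hjk (by omega))
    have hn0 := hy0 n (by omega)
    have hnT := hyT n (by omega)
    let τ : Fin (n + 1) × Fin 3 → ℝ := fun p => min (y p.1 + (p.2 : ℕ) * h) (y n + h)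
    have hτ : ∀ p, τ p ∈ Set.Icc 0 (y n + h) := fun p =>
      ⟨le_min (add_nonneg (hy0 _ p.1.2) (by positivity)) (by linarith), min_le_right _ _⟩
    have hτlt : ∀ k : Fin n, ∀ i : Fin 3, τ (k.castSucc, i) = y k + (i : ℕ) * h := by
      intro k i
      refine min_eq_left ?_
      have h1 := hsep k n k.2 (by omega)
      have h2 : ((i : ℕ) : ℝ) ≤ 2 := by exact_mod_cast (show (i : ℕ) ≤ 2 by omega)
      have h3 : ((i : ℕ) : ℝ) * h ≤ 2 * h := by gcongr
      simp only [Fin.val_castSucc]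
      linarith
    have hτ0 : τ (Fin.last n, 0) = y n := by simp [τ, hh.le]
    have hτ1 : τ (Fin.last n, 1) = y n + h := by simp [τ]
    let B : Set (Fin (n + 1) × Fin 3 → ℝ) :=
      {w | ∀ k : Fin n, |w (k.castSucc, 2) - 2 * w (k.castSucc, 1) + w (k.castSucc, 0)| ≤ r}
    have hB : MeasurableSet B := by
      simp only [B, Set.ofPred_forall]
      exact MeasurableSet.iInter fun k => measurableSet_le (by fun_prop) measurable_const
    let g : (Fin (n + 1) × Fin 3 → ℝ) → ℝ := fun w => 2 * w (Fin.last n, 1) - w (Fin.last n, 0)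
    have hg : Measurable g := by fun_prop
    have hσ : 0 < √C * h ^ β := by positivity
    have hG := hYG n τ (fun p => ⟨(hτ p).1, (hτ p).2.trans (by linarith)⟩) (y n + 2 * h)
      ⟨by linarith, hnT⟩
    have key := measure_inter_abs_sub_le (P := P) (W := fun p => Y (τ p)) (T := Y (y n + 2 * h))
      (fun p => hYm _) (hYm _) hG (r := r) hσ (fun b => by
        have := hY.le_variance_sub_sum hYm (s := y n + h) (t := y n + 2 * h) (by linarith)
          (by linarith) hnT hτ hY2 b
        refine le_trans (le_of_eq ?_) this
        rw [mul_pow, Real.sq_sqrt hC.le, ← Real.rpow_natCast (h ^ β), ← Real.rpow_mul hh.le]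
        congr 2
        · ring
        · push_cast; ring) hB hg
    have hBset : {ω | (fun p => Y (τ p) ω) ∈ B}
        = {ω | ∀ k < n, |secondDiff h (fun z => Y z ω) (y k)| ≤ r} := by
      ext ω
      simp only [B, Set.mem_ofPred_eq, hτlt, secondDiff]
      constructor
      · intro H k hk
        simpa using H ⟨k, hk⟩
      · intro H k
        simpa using H k k.2
    have hset : {ω | ∀ k < n + 1, |secondDiff h (fun z => Y z ω) (y k)| ≤ r}
        ⊆ {ω | (fun p => Y (τ p) ω) ∈ B ∧ |Y (y n + 2 * h) ω - g fun p => Y (τ p) ω| ≤ r} := by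
      intro ω hω
      refine ⟨hBset.ge fun k hk => hω k (by omega), ?_⟩
      have := hω n (by omega)
      simp only [g, hτ0, hτ1]
      convert this using 2
      simp only [secondDiff]
      ring
    calc _ ≤ _ := measure_mono hset
      _ ≤ _ := key
      _ ≤ _ := by
        rw [hBset, pow_succ, mul_comm]
        gcongr

/-- Probability that the second differences of a Gaussian process are small on half of each of
`N` successive windows. -/
lemma SLND.measure_forall_half_le {Ω : Type} [MeasurableSpace Ω] {P : Measure Ω}
    [IsProbabilityMeasure P] {Y : ℝ → Ω → ℝ} {T β C : ℝ} (hY : SLND P Y T β C)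
    (hYm : Measurable fun p : ℝ × Ω => Y p.1 p.2) (hC : 0 < C)
    (hYG : ∀ (n : ℕ) (s : Fin (n + 1) × Fin 3 → ℝ), (∀ i, s i ∈ Set.Icc 0 T) →
      ∀ t ∈ Set.Icc 0 T, HasGaussianLaw (fun ω => ((fun i => Y (s i) ω), Y t ω)) P)
    {h r : ℝ} (hh : 0 < h) {a : ℕ → ℝ} {N : ℕ} (ha0 : ∀ k < N, 0 ≤ a k)
    (haT : ∀ k < N, a k + 3 * h ≤ T) (hsep : ∀ j k, j < k → k < N → a j + 2 * h ≤ a k) :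
    P {ω | ∀ k < N, ENNReal.ofReal (h / 2) ≤
        volume (Set.Icc (a k) (a k + h) ∩ {z | |secondDiff h (fun z => Y z ω) z| ≤ r})}
      ≤ ENNReal.ofReal (2 * r / (√C * h ^ β)) ^ N := by
  have hYm' : ∀ z, Measurable (Y z) := fun z => hYm.comp (measurable_const.prodMk measurable_id)
  let D : ℝ → Ω → ℝ := fun z ω => secondDiff h (fun z => Y z ω) z
  have hD : Measurable fun p : ℝ × Ω => D p.1 p.2 := by
    have hshift : ∀ c : ℝ, Measurable fun p : ℝ × Ω => Y (p.1 + c) p.2 := fun c =>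
      hYm.comp ((measurable_fst.add_const c).prodMk measurable_snd)
    exact ((hshift _).sub ((hshift _).const_mul 2)).add hYm
  let μ : Measure (Fin N → ℝ) := Measure.pi fun k => volume.restrict (Set.Icc (a k) (a k + h))
  let E : Set ((Fin N → ℝ) × Ω) := {p | ∀ k, |D (p.1 k) p.2| ≤ r}
  have hE : MeasurableSet E := by
    simp only [E, Set.ofPred_forall]
    refine MeasurableSet.iInter fun k => measurableSet_le ?_ measurable_const
    have hk : Measurable fun p : (Fin N → ℝ) × Ω => (p.1 k, p.2) :=
      ((measurable_pi_apply k).comp measurable_fst).prodMk measurable_snd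
    exact (hD.comp hk).abs
  have hμuniv : μ Set.univ = ENNReal.ofReal h ^ N := by
    simp [μ, Measure.pi_univ]
  have hsection : ∀ ω, μ ((fun x => (x, ω)) ⁻¹' E)
      = ∏ k : Fin N, volume (Set.Icc (a k) (a k + h) ∩ {z | |D z ω| ≤ r}) := by
    intro ω
    have : (fun x : Fin N → ℝ => (x, ω)) ⁻¹' E = Set.univ.pi fun _ => {z | |D z ω| ≤ r} := by
      ext x; simp [E]
    rw [this, Measure.pi_pi]
    refine Finset.prod_congr rfl fun k _ => ?_
    have hDω : Measurable fun z => D z ω := hD.comp (measurable_id.prodMk measurable_const)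
    rw [Measure.restrict_apply (measurableSet_le hDω.abs measurable_const), Set.inter_comm]
  have hprod : ∫⁻ x, P (Prod.mk x ⁻¹' E) ∂μ = ∫⁻ ω, μ ((fun x => (x, ω)) ⁻¹' E) ∂P := by
    rw [← Measure.prod_apply hE, ← Measure.prod_apply_symm hE]
  have hupper : ∫⁻ x, P (Prod.mk x ⁻¹' E) ∂μ
      ≤ ENNReal.ofReal (r / (√C * h ^ β)) ^ N * ENNReal.ofReal h ^ N := by
    rw [← hμuniv, ← lintegral_const]
    refine lintegral_mono_ae ?_
    have hmem : ∀ᵐ x ∂μ, ∀ k : Fin N, x k ∈ Set.Icc (a k) (a k + h) := by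
      refine ae_all_iff.2 fun k => ?_
      exact (Measure.tendsto_eval_ae_ae (μ := fun k : Fin N =>
        volume.restrict (Set.Icc (a k) (a k + h))) (i := k)).eventually
          (ae_restrict_mem measurableSet_Icc)
    filter_upwards [hmem] with x hx
    let y : ℕ → ℝ := fun k => if hk : k < N then x ⟨k, hk⟩ else 0
    have hy : ∀ k (hk : k < N), y k = x ⟨k, hk⟩ := fun k hk => by simp [y, hk]
    have hyI : ∀ k < N, y k ∈ Set.Icc (a k) (a k + h) := fun k hk => hy k hk ▸ hx ⟨k, hk⟩
    refine le_trans (measure_mono ?_) (hY.measure_forall_abs_secondDiff_le hYm' hC hYG hh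
      (y := y) (N := N) (r := r) (fun k hk => (ha0 k hk).trans (hyI k hk).1)
      (fun k hk => by linarith [(hyI k hk).2, haT k hk])
      (fun j k hjk hk => by linarith [(hyI k hk).1, (hyI j (hjk.trans hk)).2, hsep j k hjk hk]))
    intro ω hω k hk
    rw [hy k hk]
    exact hω ⟨k, hk⟩
  have hlower : ENNReal.ofReal (h / 2) ^ N * P {ω | ∀ k < N, ENNReal.ofReal (h / 2) ≤
      volume (Set.Icc (a k) (a k + h) ∩ {z | |D z ω| ≤ r})}
      ≤ ∫⁻ ω, μ ((fun x => (x, ω)) ⁻¹' E) ∂P := by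
    refine le_trans ?_ (mul_meas_ge_le_lintegral
      (measurable_measure_prodMk_right hE) (ENNReal.ofReal (h / 2) ^ N))
    gcongr with ω
    intro hω
    rw [hsection]
    calc ENNReal.ofReal (h / 2) ^ N = ∏ _k : Fin N, ENNReal.ofReal (h / 2) := by simp
      _ ≤ _ := Finset.prod_le_prod' fun k _ => hω k k.2
  have hpos : ENNReal.ofReal (h / 2) ^ N ≠ 0 := pow_ne_zero _ (by simpa using hh)
  have hfin : ENNReal.ofReal (h / 2) ^ N ≠ ∞ := ENNReal.pow_ne_top ENNReal.ofReal_ne_top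
  refine (ENNReal.mul_le_mul_iff_right hpos hfin).1 ((hlower.trans hprod.ge).trans
    (hupper.trans (le_of_eq ?_)))
  rw [← mul_pow, ← mul_pow, mul_comm, ← ENNReal.ofReal_mul hh.le,
    ← ENNReal.ofReal_mul (by positivity)]
  congr 2
  ring

/-- If `f` is small in `L²` on `[a, a + 3h]`, then its second difference of step `h` is small on at
least half of `[a, a + h]`. -/
lemma half_le_volume_abs_secondDiff_le {f : ℝ → ℝ} (hf : Continuous f) {a h r : ℝ} (hh : 0 < h)
    (hr : 0 < r) (hfr : 12 * ∫ y in a..(a + 3 * h), f y ^ 2 ≤ r ^ 2 * h) :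
    ENNReal.ofReal (h / 2) ≤ volume (Set.Icc a (a + h) ∩ {z | |secondDiff h f z| ≤ r}) := by
  set D := secondDiff h f with hD
  have hDc : Continuous D := by unfold D secondDiff; fun_prop
  have hf2 : Continuous fun y => f y ^ 2 := by fun_prop
  have hD2 : Continuous fun y => D y ^ 2 := by fun_prop
  have hi : ∀ {g : ℝ → ℝ}, Continuous g → ∀ b c : ℝ, IntervalIntegrable g volume b c :=
    fun hg b c => hg.intervalIntegrable b c
  have hint : ∫ y in a..(a + h), D y ^ 2 ≤ 6 * ∫ y in a..(a + 3 * h), f y ^ 2 := by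
    have h0 := intervalIntegral.integral_comp_add_right (a := a) (b := a + h)
      (fun y => f y ^ 2) h
    have h1 := intervalIntegral.integral_comp_add_right (a := a) (b := a + h)
      (fun y => f y ^ 2) (2 * h)
    have h2 := intervalIntegral.integral_add_adjacent_intervals
      (hi hf2 a (a + h)) (hi hf2 (a + h) (a + h + h))
    have h3 := intervalIntegral.integral_add_adjacent_intervals
      (hi hf2 a (a + h + h)) (hi hf2 (a + h + h) (a + h + 2 * h))
    rw [show a + 2 * h = a + h + h by ring] at h1
    rw [show a + 3 * h = a + h + 2 * h by ring, ← h3, ← h2, ← h0, ← h1,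
      ← intervalIntegral.integral_add (hi hf2 _ _) (hi (by fun_prop) _ _),
      ← intervalIntegral.integral_add (hi (by fun_prop) _ _) (hi (by fun_prop) _ _),
      ← intervalIntegral.integral_const_mul]
    refine intervalIntegral.integral_mono_on (by linarith) (hi (by fun_prop) _ _)
      (hi (by fun_prop) _ _) fun y _ => ?_
    simp only [hD, secondDiff]
    nlinarith [sq_nonneg (f (y + 2 * h) - f y), sq_nonneg (f (y + h) + 2 * f (y + 2 * h)),
      sq_nonneg (f (y + h) + 2 * f y)]
  have hcheb : r ^ 2 * (volume.restrict (Set.Icc a (a + h))).real {z | r ^ 2 ≤ D z ^ 2}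
      ≤ ∫ y in a..(a + h), D y ^ 2 := by
    rw [intervalIntegral.integral_of_le (by linarith), ← integral_Icc_eq_integral_Ioc]
    exact mul_meas_ge_le_integral_of_nonneg (ae_of_all _ fun _ => sq_nonneg _)
      (hD2.continuousOn.integrableOn_compact isCompact_Icc) _
  have hbad : volume.real (Set.Icc a (a + h) ∩ {z | r ^ 2 ≤ D z ^ 2}) ≤ h / 2 := by
    rw [measureReal_restrict_apply (measurableSet_le measurable_const hD2.measurable),
      Set.inter_comm] at hcheb
    have : 0 < r ^ 2 := by positivity
    refine le_of_mul_le_mul_left ?_ this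
    linarith
  have hcover : Set.Icc a (a + h) ⊆ Set.Icc a (a + h) ∩ {z | |D z| ≤ r} ∪
      Set.Icc a (a + h) ∩ {z | r ^ 2 ≤ D z ^ 2} := by
    intro z hz
    rcases le_total (|D z|) r with h1 | h1
    · exact Or.inl ⟨hz, h1⟩
    · refine Or.inr ⟨hz, ?_⟩
      rw [Set.mem_ofPred_eq, ← sq_abs (D z)]
      gcongr
  have hfin : ∀ S : Set ℝ, volume (Set.Icc a (a + h) ∩ S) ≠ ∞ := fun S =>
    ((measure_mono Set.inter_subset_left).trans_lt measure_Icc_lt_top).ne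
  have htot := (measureReal_mono hcover (measure_union_ne_top (hfin _) (hfin _))).trans
    (measureReal_union_le _ _)
  rw [Real.volume_real_Icc_of_le (by linarith)] at htot
  rw [ENNReal.ofReal_le_iff_le_toReal (hfin _)]
  change h / 2 ≤ volume.real _
  linarith

/-- A pathwise criterion for `0 < GammaI α u` in terms of second differences of the primitive on
dyadic windows. -/
lemma GammaI_pos_of_secondDiff {u : ℝ → ℝ} (hu : IntegrableOn u (Set.Icc 0 π)) {α q : ℝ}
    (hα : 0 < α) (hq : 0 < q) {N : ℕ} (hN : 0 < N)
    (hlarge : ∀ n j : ℕ, (j + 1) * (1 / 2 : ℝ) ^ n ≤ π → ∃ k < N,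
      volume (Set.Icc (j * (1 / 2 : ℝ) ^ n + 3 * ((1 / 2) ^ n / (3 * N)) * k)
        (j * (1 / 2 : ℝ) ^ n + 3 * ((1 / 2) ^ n / (3 * N)) * k + (1 / 2) ^ n / (3 * N)) ∩
        {z | |secondDiff ((1 / 2) ^ n / (3 * N)) (fun y => ∫ z in (0 : ℝ)..y, u z) z|
          ≤ q * ((1 / 2) ^ n) ^ (α + 1)})
      < ENNReal.ofReal ((1 / 2) ^ n / (3 * N) / 2)) :
    0 < GammaI α u := by
  have hN' : (0 : ℝ) < N := by exact_mod_cast hN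
  have hψ : Continuous (primOfI u) :=
    intervalIntegral.continuous_primitive
      (fun _ _ => ((integrable_indicator_iff measurableSet_Icc).2 hu).intervalIntegrable) 0
  have hψu : ∀ y ∈ Set.Icc 0 π, primOfI u y = ∫ z in (0 : ℝ)..y, u z := by
    intro y hy
    refine intervalIntegral.integral_congr fun z hz => ?_
    rw [Set.uIcc_of_le hy.1] at hz
    exact Set.indicator_of_mem (show z ∈ Set.Icc 0 π from ⟨hz.1, hz.2.trans hy.2⟩) _
  have hdyadic : ∀ n j : ℕ, (j + 1) * (1 / 2 : ℝ) ^ n ≤ π → ∀ c₁ c₂ : ℝ,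
      q ^ 2 / (36 * N) * ((1 / 2 : ℝ) ^ n) ^ (2 * α + 3) ≤
        ∫ y in (j * (1 / 2 : ℝ) ^ n)..((j + 1) * (1 / 2 : ℝ) ^ n),
          (primOfI u y - c₁ - c₂ * y) ^ 2 := by
    intro n j hj c₁ c₂
    obtain ⟨k, hk, hlt⟩ := hlarge n j hj
    set d : ℝ := (1 / 2) ^ n with hd
    have hd0 : 0 < d := by positivity
    set h : ℝ := d / (3 * N) with hh
    have hh0 : 0 < h := by positivity
    set a : ℝ := j * d + 3 * h * k with ha
    have hdN : d = 3 * h * N := by rw [hh]; field_simp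
    have ha0 : 0 ≤ j * d := by positivity
    have hja : j * d ≤ a := by rw [ha]; nlinarith [show (0 : ℝ) ≤ k by positivity]
    have hkN : (k : ℝ) + 1 ≤ N := by exact_mod_cast hk
    have haj : a + 3 * h ≤ (j + 1) * d := by rw [ha]; nlinarith
    set f : ℝ → ℝ := fun y => primOfI u y - c₁ - c₂ * y with hf
    have hfc : Continuous f := by fun_prop
    by_contra! hcon
    have hsub : ∫ y in a..(a + 3 * h), f y ^ 2 ≤ ∫ y in (j * d)..((j + 1) * d), f y ^ 2 :=
      intervalIntegral.integral_mono_interval hja (by linarith) haj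
        (ae_of_all _ fun _ => sq_nonneg _) ((hfc.pow 2).intervalIntegrable _ _)
    have hr : (q * d ^ (α + 1)) ^ 2 * h = 12 * (q ^ 2 / (36 * N) * d ^ (2 * α + 3)) := by
      have hd2 : d ^ (2 * α + 3) = (d ^ (α + 1)) ^ 2 * d := by
        rw [← Real.rpow_natCast, ← Real.rpow_mul hd0.le, ← Real.rpow_add_one hd0.ne']
        congr 1
        push_cast
        ring
      rw [hd2, hh]
      field_simp
      ring
    have hhalf := half_le_volume_abs_secondDiff_le hfc hh0 (r := q * d ^ (α + 1)) (by positivity)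
      (a := a) (by rw [hr]; linarith)
    refine absurd (hhalf.trans (measure_mono ?_)) hlt.not_ge
    rintro z ⟨hz, hzr⟩
    refine ⟨hz, ?_⟩
    rw [Set.mem_ofPred_eq] at hzr ⊢
    convert hzr using 2
    simp only [secondDiff, hf]
    rw [← hψu z ⟨by linarith [hz.1], by linarith [hz.2]⟩,
      ← hψu (z + h) ⟨by linarith [hz.1], by linarith [hz.2]⟩,
      ← hψu (z + 2 * h) ⟨by linarith [hz.1], by linarith [hz.2]⟩]
    ring
  have hlower : ∀ v ∈ {v : ℝ | ∃ δ ∈ Set.Ioo (0:ℝ) 1, ∃ ybar ∈ Set.Icc (0:ℝ) (π - δ),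
      ∃ c₁ c₂ : ℝ, v = δ ^ (-(2 * α + 3)) *
        ∫ y in ybar..(ybar + δ), (primOfI u y - c₁ - c₂ * y) ^ 2},
      q ^ 2 / (36 * N) * (1 / 4) ^ (2 * α + 3) ≤ v := by
    rintro v ⟨δ, hδ, b, hb, c₁, c₂, rfl⟩
    obtain ⟨n, hn1, hn2⟩ := exists_nat_pow_near_of_lt_one (x := δ / 2) (y := (1 / 2 : ℝ))
      (by linarith [hδ.1]) (by linarith [hδ.2]) (by norm_num) (by norm_num)
    set d : ℝ := (1 / 2) ^ (n + 1) with hd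
    have hd0 : 0 < d := by positivity
    have hdδ : δ / 4 ≤ d := by rw [hd, pow_succ]; linarith
    set j := ⌈b / d⌉₊ with hj
    have hj1 : b ≤ j * d := (div_le_iff₀ hd0).1 (Nat.le_ceil _)
    have hj2 : (j : ℝ) * d < b + d := by
      have := Nat.ceil_lt_add_one (div_nonneg hb.1 hd0.le)
      rw [← lt_div_iff₀ hd0, add_div, div_self hd0.ne']
      exact this
    have hj3 : (j + 1) * d ≤ b + δ := by linarith
    have hfc : Continuous fun y => (primOfI u y - c₁ - c₂ * y) ^ 2 := by fun_prop
    have hsub : ∫ y in (j * d)..((j + 1) * d), (primOfI u y - c₁ - c₂ * y) ^ 2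
        ≤ ∫ y in b..(b + δ), (primOfI u y - c₁ - c₂ * y) ^ 2 :=
      intervalIntegral.integral_mono_interval hj1 (by linarith) hj3
        (ae_of_all _ fun _ => sq_nonneg _) (hfc.intervalIntegrable _ _)
    have hD := (hdyadic (n + 1) j (hj3.trans (by linarith [hb.2])) c₁ c₂).trans hsub
    have hδ4 : (δ / 4) ^ (2 * α + 3) ≤ d ^ (2 * α + 3) :=
      Real.rpow_le_rpow (by linarith [hδ.1]) hdδ (by linarith)
    rw [Real.rpow_neg hδ.1.le, ← div_eq_inv_mul, le_div_iff₀ (Real.rpow_pos_of_pos hδ.1 _),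
      mul_assoc, ← Real.mul_rpow (by norm_num) hδ.1.le]
    refine le_trans ?_ hD
    rw [show 1 / 4 * δ = δ / 4 by ring]
    gcongr
  refine Real.sqrt_pos.2 (lt_of_lt_of_le (?_ : 0 < q ^ 2 / (36 * N) * (1 / 4 : ℝ) ^ (2 * α + 3))
    (le_csInf ⟨_, 1 / 2, by norm_num, 0, ⟨le_rfl, by linarith [Real.two_le_pi]⟩, 0, 0, rfl⟩
      hlower))
  positivity

/-- For small `q`, with high probability there is no dyadic interval of `[0, T]` all of whose `N`
windows carry small second differences. -/
lemma SLND.measure_exists_dyadic_le {Ω : Type} [MeasurableSpace Ω] {P : Measure Ω}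
    [IsProbabilityMeasure P] {Y : ℝ → Ω → ℝ} {T H C : ℝ} (hY : SLND P Y T (1 + H) C)
    (hYm : Measurable fun p : ℝ × Ω => Y p.1 p.2) (hC : 0 < C)
    (hYG : ∀ (n : ℕ) (s : Fin (n + 1) × Fin 3 → ℝ), (∀ i, s i ∈ Set.Icc 0 T) →
      ∀ t ∈ Set.Icc 0 T, HasGaussianLaw (fun ω => ((fun i => Y (s i) ω), Y t ω)) P)
    (hT : T ≤ 4) {α q : ℝ} (hq : 0 ≤ q) {N : ℕ} (hN : 0 < N) (hNα : 3 ≤ (α - H) * N) :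
    P {ω | ∃ n j : ℕ, (j + 1) * (1 / 2 : ℝ) ^ n ≤ T ∧ ∀ k < N,
      ENNReal.ofReal ((1 / 2) ^ n / (3 * N) / 2) ≤
      volume (Set.Icc (j * (1 / 2 : ℝ) ^ n + 3 * ((1 / 2) ^ n / (3 * N)) * k)
        (j * (1 / 2 : ℝ) ^ n + 3 * ((1 / 2) ^ n / (3 * N)) * k + (1 / 2) ^ n / (3 * N)) ∩
        {z | |secondDiff ((1 / 2) ^ n / (3 * N)) (fun z => Y z ω) z|
          ≤ q * ((1 / 2) ^ n) ^ (α + 1)})}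
      ≤ ENNReal.ofReal (4 * (2 * (3 * N) ^ (1 + H) / √C * q) ^ N) *
        ∑' n : ℕ, ENNReal.ofReal (1 / 4) ^ n := by
  have hN' : (0 : ℝ) < N := by exact_mod_cast hN
  set κ : ℝ := 2 * (3 * N) ^ (1 + H) / √C with hκ
  have hκ0 : 0 ≤ κ := by positivity
  set B : ℕ → ℕ → Set Ω := fun n j => {ω | ∀ k < N,
      ENNReal.ofReal ((1 / 2) ^ n / (3 * N) / 2) ≤
      volume (Set.Icc (j * (1 / 2 : ℝ) ^ n + 3 * ((1 / 2) ^ n / (3 * N)) * k)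
        (j * (1 / 2 : ℝ) ^ n + 3 * ((1 / 2) ^ n / (3 * N)) * k + (1 / 2) ^ n / (3 * N)) ∩
        {z | |secondDiff ((1 / 2) ^ n / (3 * N)) (fun z => Y z ω) z|
          ≤ q * ((1 / 2) ^ n) ^ (α + 1)})} with hB
  set J : ℕ → Finset ℕ := fun n => {j ∈ Finset.range (4 * 2 ^ n) | (j + 1) * (1 / 2 : ℝ) ^ n ≤ T}
  have hBle : ∀ n, ∀ j ∈ J n, P (B n j) ≤ ENNReal.ofReal ((κ * q) ^ N * (1 / 8) ^ n) := by
    intro n j hj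
    have hjT : (j + 1) * (1 / 2 : ℝ) ^ n ≤ T := (Finset.mem_filter.1 hj).2
    simp only [hB]
    set d : ℝ := (1 / 2) ^ n with hd
    have hd0 : 0 < d := by positivity
    have hd1 : d ≤ 1 := pow_le_one₀ (by norm_num) (by norm_num)
    set h : ℝ := d / (3 * N) with hh
    have hh0 : 0 < h := by positivity
    have hdN : d = 3 * h * N := by rw [hh]; field_simp
    have hjd : 0 ≤ j * d := by positivity
    refine (hY.measure_forall_half_le hYm hC hYG hh0 (a := fun k => j * d + 3 * h * k)
      (fun k _ => by positivity) (fun k hk => ?_) (fun i k hik _ => ?_)).trans ?_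
    · have hkN : (k : ℝ) + 1 ≤ N := by exact_mod_cast hk
      nlinarith
    · have hik' : (i : ℝ) + 1 ≤ k := by exact_mod_cast hik
      nlinarith
    · have hbase : 2 * (q * d ^ (α + 1)) / (√C * h ^ (1 + H)) = κ * q * d ^ (α - H) := by
        rw [show α + 1 = (α - H) + (1 + H) by ring, Real.rpow_add hd0, hh,
          Real.div_rpow hd0.le (by positivity), hκ]
        have : 0 < d ^ (1 + H) := Real.rpow_pos_of_pos hd0 _
        field_simp
      rw [hbase, ← ENNReal.ofReal_pow (by positivity), mul_pow]
      gcongr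
      calc (d ^ (α - H)) ^ N = d ^ ((α - H) * N) := by
            rw [Real.rpow_mul hd0.le, Real.rpow_natCast]
        _ ≤ d ^ (3 : ℝ) := Real.rpow_le_rpow_of_exponent_ge hd0 hd1 hNα
        _ = (1 / 8) ^ n := by
            rw [show (3 : ℝ) = ((3 : ℕ) : ℝ) by norm_num, Real.rpow_natCast, hd, pow_right_comm]
            norm_num
  have hcover : {ω | ∃ n j : ℕ, (j + 1) * (1 / 2 : ℝ) ^ n ≤ T ∧ ω ∈ B n j}
      ⊆ ⋃ n, ⋃ j ∈ J n, B n j := by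
    rintro ω ⟨n, j, hj, hω⟩
    refine Set.mem_iUnion.2 ⟨n, Set.mem_iUnion₂.2 ⟨j, Finset.mem_filter.2 ⟨?_, hj⟩, hω⟩⟩
    rw [Finset.mem_range]
    have h1 : ((j : ℝ) + 1) * (1 / 2) ^ n ≤ 4 := hj.trans hT
    rw [one_div, inv_pow, ← div_eq_mul_inv, div_le_iff₀ (by positivity)] at h1
    exact_mod_cast h1
  calc P {ω | ∃ n j : ℕ, (j + 1) * (1 / 2 : ℝ) ^ n ≤ T ∧ ω ∈ B n j}
      ≤ ∑' n, ∑ j ∈ J n, P (B n j) := (measure_mono hcover).trans ((measure_iUnion_le _).trans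
        (ENNReal.tsum_le_tsum fun n => measure_biUnion_finset_le _ _))
    _ ≤ ∑' n : ℕ, ENNReal.ofReal (4 * (κ * q) ^ N) * ENNReal.ofReal (1 / 4) ^ n := by
        refine ENNReal.tsum_le_tsum fun n => (Finset.sum_le_card_nsmul _ _ _ (hBle n)).trans ?_
        rw [nsmul_eq_mul, ← ENNReal.ofReal_natCast, ← ENNReal.ofReal_pow (by norm_num),
          ← ENNReal.ofReal_mul (by positivity), ← ENNReal.ofReal_mul (by positivity)]
        refine ENNReal.ofReal_le_ofReal ?_
        have hcard : ((J n).card : ℝ) ≤ 4 * 2 ^ n := by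
          exact_mod_cast (Finset.card_filter_le _ _).trans (Finset.card_range _).le
        calc ((J n).card : ℝ) * ((κ * q) ^ N * (1 / 8) ^ n)
            ≤ 4 * 2 ^ n * ((κ * q) ^ N * (1 / 8) ^ n) := by gcongr
          _ = 4 * (κ * q) ^ N * (2 ^ n * (1 / 8) ^ n) := by ring
          _ = 4 * (κ * q) ^ N * (1 / 4) ^ n := by rw [← mul_pow]; norm_num
    _ = _ := ENNReal.tsum_mul_left
end GaussianTools

/-- Corollary 4.15: let `X` be a jointly measurable Gaussian process on
`[0,π]` with a.s. integrable paths such that `Y_y = ∫₀^y X_z dz` is `(1+H)`-SLND. Then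
`P(Γ_α(X) > 0) = 1` for every `α > H`. -/
theorem gauss_wei_condition
    {Ω : Type} [MeasurableSpace Ω] (P : Measure Ω) [IsProbabilityMeasure P]
    (H : ℝ) (hH : H ∈ Set.Ioo (0:ℝ) 1)
    (X : ℝ → Ω → ℝ) (hX_meas : Measurable fun p : ℝ × Ω => X p.1 p.2)
    (hX_gauss : IsGaussianProcess P X)
    (hX_int : ∀ᵐ ω ∂P, IntegrableOn (fun y => X y ω) (Set.Icc 0 π))
    (CY : ℝ) (hCY : 0 < CY)
    (hY_slnd : SLND P (fun y ω => ∫ z in (0:ℝ)..y, X z ω) π (1 + H) CY) :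
    ∀ α : ℝ, H < α → P {ω | 0 < GammaI α fun y => X y ω} = 1 := by
  intro α hα
  obtain ⟨N, hN⟩ := exists_nat_gt (3 / (α - H))
  have hαH : 0 < α - H := sub_pos.2 hα
  have hN0 : 0 < N := by exact_mod_cast (by positivity : (0 : ℝ) < 3 / (α - H)).trans hN
  have hNα : 3 ≤ (α - H) * N := by
    rw [div_lt_iff₀ hαH] at hN
    linarith
  have hbound := fun m : ℕ => hY_slnd.measure_exists_dyadic_le
    (measurable_primitive hX_meas) hCY
    (fun n s hs t ht => hasGaussianLaw_primitive_prod hX_meas hX_gauss hX_int hs ht)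
    Real.pi_le_four (q := 1 / ((m : ℝ) + 1)) (by positivity) hN0 hNα
  have hlim : Filter.Tendsto (fun m : ℕ => ENNReal.ofReal
      (4 * (2 * (3 * N) ^ (1 + H) / √CY * (1 / ((m : ℝ) + 1))) ^ N) *
        ∑' n : ℕ, ENNReal.ofReal (1 / 4) ^ n) Filter.atTop (nhds 0) := by
    have hsum : ∑' n : ℕ, ENNReal.ofReal (1 / 4) ^ n ≠ ∞ := by
      rw [ENNReal.tsum_geometric, ENNReal.inv_ne_top, ← ENNReal.ofReal_one,
        ← ENNReal.ofReal_sub _ (by norm_num)]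
      simp only [ne_eq, ENNReal.ofReal_eq_zero, not_le]
      norm_num
    have hreal := (((tendsto_one_div_add_atTop_nhds_zero_nat (𝕜 := ℝ)).const_mul
      (2 * (3 * N) ^ (1 + H) / √CY)).pow N).const_mul 4
    have hmul := ENNReal.Tendsto.mul_const (ENNReal.tendsto_ofReal hreal) (Or.inr hsum)
    simpa [hN0.ne'] using hmul
  have hnull := le_antisymm (ge_of_tendsto' hlim fun m =>
    (measure_mono (Set.iInter_subset _ m)).trans (hbound m)) zero_le
  have hpos : ∀ᵐ ω ∂P, 0 < GammaI α fun y => X y ω := by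
    filter_upwards [hX_int, measure_eq_zero_iff_ae_notMem.1 hnull] with ω hint hω
    obtain ⟨m, hm⟩ := not_forall.1 (mt Set.mem_iInter.2 hω)
    refine GammaI_pos_of_secondDiff hint (hH.1.trans hα) (q := 1 / ((m : ℝ) + 1))
      (by positivity) hN0 fun n j hj => ?_
    by_contra! hcon
    exact hm ⟨n, j, hj, hcon⟩
  rw [measure_congr (Filter.eventuallyEq_univ.2 hpos), measure_univ]
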